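/- With X₂ = X₃ and the same fixed basis used for both, the automorphisms φ₁, φ₂, φ₃ of L commute with τ, hence restrict to automorphisms of the 52-dimensional fixed subalgebra L^τ; the induced decomposition L^τ = ⊕_{(a,b,c)∈ℤ₃³} (L^τ ∩ L_{(a,b,c)}) is a ℤ₃³-grading of L^τ whose zero component L^τ ∩ L_{(0,0,0)} is 0 and all of whose 26 nonzero components have dimension 2. -/

import Mathlib

noncomputable section

open Matrix
open scoped BigOperators

variable (F : Type*) [Field F] [IsAlgClosed F] [CharZero F]

set_option linter.unusedSectionVars false

/-- `gl₃ = M₃(F)`, the matrix algebra of a 3-dimensional space in a fixed basis. -/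
abbrev gl3 := Matrix (Fin 3) (Fin 3) F

/-- Coordinates of a tensor in `X₁ ⊗ X₂ ⊗ X₃` with respect to the fixed bases. -/
abbrev T3 := Fin 3 → Fin 3 → Fin 3 → F

/-- The ambient space `(gl₃)³ × (X₁⊗X₂⊗X₃) × (X₁*⊗X₂*⊗X₃*)` containing the model of e₆. -/
abbrev Mbig := (gl3 F × gl3 F × gl3 F) × (T3 F × T3 F)

/-- Trace-zero matrices: the coordinate model of `sl(X_i)`. -/
def sl3 : Submodule F (gl3 F) where
  carrier := {g | Matrix.trace g = 0}
  add_mem' := by intro a b ha hb; simp_all [Matrix.trace_add]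
  zero_mem' := by simp
  smul_mem' := by intro c a ha; simp_all [Matrix.trace_smul]

lemma mem_sl3 {g : gl3 F} : g ∈ sl3 F ↔ Matrix.trace g = 0 := Iff.rfl

/-- The model of `e₆`: `sl(X₁)⊕sl(X₂)⊕sl(X₃) ⊕ X₁⊗X₂⊗X₃ ⊕ X₁*⊗X₂*⊗X₃*`, as a submodule
of the ambient space. -/
def Lsub : Submodule F (Mbig F) :=
  ((sl3 F).prod ((sl3 F).prod (sl3 F))).prod
    ((⊤ : Submodule F (T3 F)).prod (⊤ : Submodule F (T3 F)))

/-- The fixed alternating trilinear form: determinant of the matrix with rows `x, y, z`. -/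
def det3 (x y z : Fin 3 → F) : F := Matrix.det (Matrix.of ![x, y, z])

/-- The Levi-Civita symbol `ε_{abc} = det(e_a, e_b, e_c)`, encoding the identification
`X∧X ≅ X*` given by `x∧y ↦ det(x,y,−)` (and dually `X*∧X* ≅ X`). -/
def eps (a b c : Fin 3) : F :=
  det3 F (Pi.single a 1) (Pi.single b 1) (Pi.single c 1)

/-- Coordinates of `[⊗x_i, ⊗y_i] = ⊗(x_i ∧ y_i)` (and of `[⊗f_i, ⊗g_i] = ⊗(f_i ∧ g_i)`). -/
def wedgeT (x y : T3 F) : T3 F := fun c d e =>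
  ∑ i, ∑ j, ∑ k, ∑ l, ∑ m, ∑ n,
    x i j k * y l m n * eps F i l c * eps F j m d * eps F k n e

/-- Coordinates of the action of `(g₁,g₂,g₃) ∈ sl(X₁)⊕sl(X₂)⊕sl(X₃)` on `X₁⊗X₂⊗X₃`. -/
def actT (g : gl3 F × gl3 F × gl3 F) (x : T3 F) : T3 F := fun i j k =>
  (∑ a, g.1 i a * x a j k) + (∑ a, g.2.1 j a * x i a k) + (∑ a, g.2.2 k a * x i j a)

/-- Coordinates of the action of `(g₁,g₂,g₃)` on `X₁*⊗X₂*⊗X₃*` (minus the dual action). -/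
def coactT (g : gl3 F × gl3 F × gl3 F) (f : T3 F) : T3 F := fun i j k =>
  -((∑ a, g.1 a i * f a j k) + (∑ a, g.2.1 a j * f i a k) + (∑ a, g.2.2 a k * f i j a))

/-- The full contraction `⟨f, x⟩ = Σ f_{ijk} x_{ijk}`. -/
def tpair (f x : T3 F) : F := ∑ i, ∑ j, ∑ k, f i j k * x i j k

/-- The `sl(X₁)`-component of `[⊗f_i, ⊗x_i]`. -/
def pair1 (f x : T3 F) : gl3 F := Matrix.of fun r s =>
  (∑ j, ∑ k, f s j k * x r j k) - (1/3 : F) * (if r = s then tpair F f x else 0)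

/-- The `sl(X₂)`-component of `[⊗f_i, ⊗x_i]`. -/
def pair2 (f x : T3 F) : gl3 F := Matrix.of fun r s =>
  (∑ i, ∑ k, f i s k * x i r k) - (1/3 : F) * (if r = s then tpair F f x else 0)

/-- The `sl(X₃)`-component of `[⊗f_i, ⊗x_i]`. -/
def pair3 (f x : T3 F) : gl3 F := Matrix.of fun r s =>
  (∑ i, ∑ j, f i j s * x i j r) - (1/3 : F) * (if r = s then tpair F f x else 0)

/-- The bracket of the model of `e₆`, written out on the ambient coordinate space. -/
def B (u v : Mbig F) : Mbig F :=
  ( ( (u.1.1 * v.1.1 - v.1.1 * u.1.1) + pair1 F u.2.2 v.2.1 - pair1 F v.2.2 u.2.1,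
      (u.1.2.1 * v.1.2.1 - v.1.2.1 * u.1.2.1) + pair2 F u.2.2 v.2.1 - pair2 F v.2.2 u.2.1,
      (u.1.2.2 * v.1.2.2 - v.1.2.2 * u.1.2.2) + pair3 F u.2.2 v.2.1 - pair3 F v.2.2 u.2.1 ),
    ( actT F u.1 v.2.1 - actT F v.1 u.2.1 + wedgeT F u.2.2 v.2.2,
      coactT F u.1 v.2.2 - coactT F v.1 u.2.2 + wedgeT F u.2.1 v.2.1 ) )

lemma trace_pair1 (f x : T3 F) : Matrix.trace (pair1 F f x) = 0 := by
  simp only [pair1, Matrix.trace, Matrix.diag, Matrix.of_apply, if_pos, tpair,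
    Finset.sum_sub_distrib, Finset.sum_const, Finset.card_univ, Fintype.card_fin,
    nsmul_eq_mul, Nat.cast_ofNat]
  ring

lemma trace_pair2 (f x : T3 F) : Matrix.trace (pair2 F f x) = 0 := by
  simp only [pair2, Matrix.trace, Matrix.diag, Matrix.of_apply, if_pos, tpair,
    Finset.sum_sub_distrib, Finset.sum_const, Finset.card_univ, Fintype.card_fin,
    nsmul_eq_mul, Nat.cast_ofNat]
  rw [Finset.sum_comm]
  ring

lemma sum_rotate (h : Fin 3 → Fin 3 → Fin 3 → F) :
    ∑ r, ∑ i, ∑ j, h i j r = ∑ i, ∑ j, ∑ r, h i j r := by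
  rw [Finset.sum_comm]
  exact Finset.sum_congr rfl fun i _ => Finset.sum_comm

lemma trace_pair3 (f x : T3 F) : Matrix.trace (pair3 F f x) = 0 := by
  simp only [pair3, Matrix.trace, Matrix.diag, Matrix.of_apply, if_pos, tpair,
    Finset.sum_sub_distrib, Finset.sum_const, Finset.card_univ, Fintype.card_fin,
    nsmul_eq_mul, Nat.cast_ofNat]
  rw [sum_rotate F (fun i j r => f i j r * x i j r)]
  ring

/-- The bracket takes values in (the ambient copy of) `L`. -/
lemma B_mem (u v : Mbig F) : B F u v ∈ Lsub F := by
  refine ⟨⟨?_, ?_, ?_⟩, trivial, trivial⟩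
  · show Matrix.trace ((u.1.1 * v.1.1 - v.1.1 * u.1.1)
        + pair1 F u.2.2 v.2.1 - pair1 F v.2.2 u.2.1) = 0
    rw [Matrix.trace_sub, Matrix.trace_add, Matrix.trace_sub, trace_pair1, trace_pair1,
      Matrix.trace_mul_comm]
    ring
  · show Matrix.trace ((u.1.2.1 * v.1.2.1 - v.1.2.1 * u.1.2.1)
        + pair2 F u.2.2 v.2.1 - pair2 F v.2.2 u.2.1) = 0
    rw [Matrix.trace_sub, Matrix.trace_add, Matrix.trace_sub, trace_pair2, trace_pair2,
      Matrix.trace_mul_comm]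
    ring
  · show Matrix.trace ((u.1.2.2 * v.1.2.2 - v.1.2.2 * u.1.2.2)
        + pair3 F u.2.2 v.2.1 - pair3 F v.2.2 u.2.1) = 0
    rw [Matrix.trace_sub, Matrix.trace_add, Matrix.trace_sub, trace_pair3, trace_pair3,
      Matrix.trace_mul_comm]
    ring

/-- The bracket of the model of `e₆` on `L` itself. -/
def Bsub (u v : ↥(Lsub F)) : ↥(Lsub F) := ⟨B F ↑u ↑v, B_mem F ↑u ↑v⟩


/-- `φ₁`: the automorphism of the ℤ₃-grading `L = L₀ ⊕ L₁ ⊕ L₂`: identity on `L₀`,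
multiplication by `ω` on `L₁` and by `ω²` on `L₂`. -/
def phi1 (ω : F) : Mbig F →ₗ[F] Mbig F where
  toFun u := (u.1, (ω • u.2.1, ω ^ 2 • u.2.2))
  map_add' u v := by
    ext <;> simp [mul_add]
  map_smul' c u := by
    ext <;> simp [smul_eq_mul] <;> ring

/-- The cyclic shift matrix `P : e_a ↦ e_{a+1}`. -/
def Pcyc : gl3 F := !![0, 0, 1; 1, 0, 0; 0, 1, 0]

/-- `φ₂`: the automorphism extending `u_i⊗v_j⊗w_k ↦ u_{i+1}⊗v_{j+1}⊗w_{k+1}`, acting by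
conjugation by the cyclic shift on each `sl(X_i)` and by the inverse-dual maps on `L₂`. -/
def phi2 : Mbig F →ₗ[F] Mbig F where
  toFun u := ((Pcyc F * u.1.1 * (Pcyc F)ᵀ, Pcyc F * u.1.2.1 * (Pcyc F)ᵀ,
               Pcyc F * u.1.2.2 * (Pcyc F)ᵀ),
              ((fun i j k => u.2.1 (i - 1) (j - 1) (k - 1)),
               (fun i j k => u.2.2 (i - 1) (j - 1) (k - 1))))
  map_add' u v := by
    ext <;> simp [Matrix.mul_add, Matrix.add_mul]
  map_smul' c u := by
    ext <;> simp [Matrix.mul_smul, Matrix.smul_mul]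

/-- `φ₃`: the automorphism extending `u_i⊗v_j⊗w_k ↦ ω^{i+j+k}·u_i⊗v_j⊗w_k`, acting by
conjugation by `diag(1,ω,ω²)` on each `sl(X_i)` and by the inverse-dual maps on `L₂`. -/
def phi3 (ω : F) : Mbig F →ₗ[F] Mbig F where
  toFun u :=
    ((Matrix.diagonal ![1, ω, ω ^ 2] * u.1.1 * Matrix.diagonal ![1, ω ^ 2, ω],
      Matrix.diagonal ![1, ω, ω ^ 2] * u.1.2.1 * Matrix.diagonal ![1, ω ^ 2, ω],
      Matrix.diagonal ![1, ω, ω ^ 2] * u.1.2.2 * Matrix.diagonal ![1, ω ^ 2, ω]),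
     ((fun i j k => ω ^ (i.val + j.val + k.val) * u.2.1 i j k),
      (fun i j k => ω ^ (2 * (i.val + j.val + k.val)) * u.2.2 i j k)))
  map_add' u v := by
    ext <;> simp [Matrix.mul_add, Matrix.add_mul, mul_add] <;> ring
  map_smul' c u := by
    ext <;> simp [Matrix.mul_smul, Matrix.smul_mul, smul_eq_mul] <;> ring

/-- The `c`-eigenspace of an endomorphism of the ambient space. -/
def eigAmb (φ : Mbig F →ₗ[F] Mbig F) (c : F) : Submodule F (Mbig F) :=
  LinearMap.ker (φ - c • LinearMap.id)

/-- `ω^a` for `a : ℤ₃`. -/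
def wpow (ω : F) (a : ZMod 3) : F := ω ^ a.val

/-- The homogeneous component `L_{(a,b,c)}` of the `ℤ₃³`-grading of the model of `e₆`
determined by the commuting automorphisms `φ₁, φ₂, φ₃`. -/
def Lcomp (ω : F) (g : ZMod 3 × ZMod 3 × ZMod 3) : Submodule F ↥(Lsub F) :=
  Submodule.comap (Lsub F).subtype
    (eigAmb F (phi1 F ω) (wpow F ω g.1) ⊓ eigAmb F (phi2 F) (wpow F ω g.2.1) ⊓
      eigAmb F (phi3 F ω) (wpow F ω g.2.2))

/-- The order-2 automorphism `τ` of `L` (taking `X₂ = X₃`): identity on `sl(X₁)`, swapping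
`sl(X₂)` and `sl(X₃)`, and exchanging the last two tensor factors on `L₁` and `L₂`. -/
def tau : Mbig F →ₗ[F] Mbig F where
  toFun u := ((u.1.1, u.1.2.2, u.1.2.1),
              ((fun i j k => u.2.1 i k j), (fun i j k => u.2.2 i k j)))
  map_add' u v := by ext <;> simp
  map_smul' c u := by ext <;> simp

/-- The fixed subalgebra `L^τ = {x ∈ L : τ(x) = x}`, a model of `f₄`. -/
def Ltau : Submodule F ↥(Lsub F) :=
  Submodule.comap (Lsub F).subtype (LinearMap.ker (tau F - LinearMap.id))

/-! ### Powers of the cube root of unity indexed by `Fin 3` -/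

section aux
variable {F}

/-- `ω^i` for an index `i : Fin 3`. -/
def W3 (ω : F) (i : Fin 3) : F := ω ^ i.val

lemma wpow_eq_W3 (ω : F) (a : ZMod 3) : wpow F ω a = W3 ω a := rfl

lemma pow_eq_W3 {ω : F} (h3 : ω ^ 3 = 1) (n : ℕ) (i : Fin 3) (h : n % 3 = i.val) :
    ω ^ n = W3 ω i := by
  rw [W3, ← h, ← pow_mod_orderOf]
  conv_rhs => rw [← pow_mod_orderOf]
  have : orderOf ω ∣ 3 := orderOf_dvd_of_pow_eq_one h3
  rw [Nat.mod_mod_of_dvd _ this]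

lemma W3_add {ω : F} (h3 : ω ^ 3 = 1) (i j : Fin 3) : W3 ω (i + j) = W3 ω i * W3 ω j := by
  rw [W3, W3, W3, ← pow_add]
  exact (pow_eq_W3 h3 _ (i + j) (Fin.val_add i j).symm).symm

lemma W3_zero (ω : F) : W3 ω 0 = 1 := by simp [W3]

lemma W3_ne_zero {ω : F} (h3 : ω ^ 3 = 1) (i : Fin 3) : W3 ω i ≠ 0 := by
  intro h
  have := W3_add h3 i (-i)
  rw [h, add_neg_cancel, W3_zero] at this
  simp at this

lemma W3_neg {ω : F} (h3 : ω ^ 3 = 1) (i : Fin 3) : W3 ω (-i) * W3 ω i = 1 := by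
  rw [← W3_add h3, neg_add_cancel, W3_zero]

lemma W3_inj {ω : F} (hω : IsPrimitiveRoot ω 3) {i j : Fin 3} (h : W3 ω i = W3 ω j) : i = j :=
  Fin.ext (hω.pow_inj i.isLt j.isLt h)

/-! ### Coordinates of the automorphisms -/

lemma Pconj_apply (M : gl3 F) (r s : Fin 3) :
    (Pcyc F * M * (Pcyc F)ᵀ) r s = M (r - 1) (s - 1) := by
  simp only [Matrix.mul_apply, Fin.sum_univ_three, Matrix.transpose_apply]
  fin_cases r <;> fin_cases s <;> simp [Pcyc] <;> rfl

lemma Pconj_eq (M : gl3 F) :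
    Pcyc F * M * (Pcyc F)ᵀ = M.submatrix (Equiv.subRight (1 : Fin 3)) (Equiv.subRight 1) := by
  ext r s; rw [Pconj_apply]; rfl

lemma Dconj_apply {ω : F} (M : gl3 F) (r s : Fin 3) :
    (Matrix.diagonal ![1, ω, ω ^ 2] * M * Matrix.diagonal ![1, ω ^ 2, ω]) r s
      = W3 ω r * W3 ω (-s) * M r s := by
  have h1 : (![1, ω, ω ^ 2] : Fin 3 → F) r = W3 ω r := by
    fin_cases r <;> simp [W3]
  have h2 : (![1, ω ^ 2, ω] : Fin 3 → F) s = W3 ω (-s) := by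
    fin_cases s <;> simp [W3]
    have : (-2 : Fin 3).val = 1 := rfl
    rw [this, pow_one]
  rw [Matrix.mul_diagonal, Matrix.diagonal_mul, h1, h2]
  ring

lemma W3_sum3 {ω : F} (h3 : ω ^ 3 = 1) (i j k : Fin 3) :
    ω ^ (i.val + j.val + k.val) = W3 ω (i + j + k) := by
  rw [W3_add h3, W3_add h3, W3, W3, W3, pow_add, pow_add]

lemma W3_sum3' {ω : F} (h3 : ω ^ 3 = 1) (i j k : Fin 3) :
    ω ^ (2 * (i.val + j.val + k.val)) = W3 ω (-(i + j + k)) := by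
  have h1 := W3_neg h3 (i + j + k)
  have h0 := W3_ne_zero h3 (i + j + k)
  have h2 : ω ^ (2 * (i.val + j.val + k.val)) * W3 ω (i + j + k) = 1 := by
    rw [← W3_sum3 h3, ← pow_add,
      show 2 * (i.val + j.val + k.val) + (i.val + j.val + k.val)
        = 3 * (i.val + j.val + k.val) by ring, pow_mul, h3, one_pow]
  exact mul_right_cancel₀ h0 (h2.trans h1.symm)

/-! ### The bracket and scalars -/

lemma T3_ext {x y : T3 F} (h : ∀ i j k, x i j k = y i j k) : x = y := by
  funext i j k; exact h i j k

lemma wedgeT_smul (c d : F) (x y : T3 F) :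
    wedgeT F (c • x) (d • y) = (c * d) • wedgeT F x y := by
  refine T3_ext fun i j k => ?_
  simp only [wedgeT, Pi.smul_apply, smul_eq_mul, Finset.mul_sum]
  repeat refine Finset.sum_congr rfl fun _ _ => ?_
  ring

lemma actT_smul (c d : F) (g : gl3 F × gl3 F × gl3 F) (x : T3 F) :
    actT F (c • g) (d • x) = (c * d) • actT F g x := by
  refine T3_ext fun i j k => ?_
  simp only [actT, Prod.smul_fst, Prod.smul_snd, Matrix.smul_apply, Pi.smul_apply, smul_eq_mul,
    Fin.sum_univ_three]
  ring

lemma coactT_smul (c d : F) (g : gl3 F × gl3 F × gl3 F) (x : T3 F) :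
    coactT F (c • g) (d • x) = (c * d) • coactT F g x := by
  refine T3_ext fun i j k => ?_
  simp only [coactT, Prod.smul_fst, Prod.smul_snd, Matrix.smul_apply, Pi.smul_apply, smul_eq_mul,
    Fin.sum_univ_three]
  ring

lemma tpair_smul (c d : F) (x y : T3 F) :
    tpair F (c • x) (d • y) = (c * d) * tpair F x y := by
  simp only [tpair, Pi.smul_apply, smul_eq_mul, Finset.mul_sum]
  repeat refine Finset.sum_congr rfl fun _ _ => ?_
  ring

lemma pair1_smul (c d : F) (x y : T3 F) :
    pair1 F (c • x) (d • y) = (c * d) • pair1 F x y := by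
  ext r s
  simp only [pair1, Matrix.of_apply, Matrix.smul_apply, tpair_smul, Pi.smul_apply, smul_eq_mul,
    Fin.sum_univ_three]
  split_ifs <;> ring

lemma pair2_smul (c d : F) (x y : T3 F) :
    pair2 F (c • x) (d • y) = (c * d) • pair2 F x y := by
  ext r s
  simp only [pair2, Matrix.of_apply, Matrix.smul_apply, tpair_smul, Pi.smul_apply, smul_eq_mul,
    Fin.sum_univ_three]
  split_ifs <;> ring

lemma pair3_smul (c d : F) (x y : T3 F) :
    pair3 F (c • x) (d • y) = (c * d) • pair3 F x y := by
  ext r s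
  simp only [pair3, Matrix.of_apply, Matrix.smul_apply, tpair_smul, Pi.smul_apply, smul_eq_mul,
    Fin.sum_univ_three]
  split_ifs <;> ring

lemma Mbig_ext {u v : Mbig F} (h1 : u.1.1 = v.1.1) (h2 : u.1.2.1 = v.1.2.1)
    (h3 : u.1.2.2 = v.1.2.2) (h4 : u.2.1 = v.2.1) (h5 : u.2.2 = v.2.2) : u = v :=
  Prod.ext (Prod.ext h1 (Prod.ext h2 h3)) (Prod.ext h4 h5)

lemma B_smul (c d : F) (u v : Mbig F) : B F (c • u) (d • v) = (c * d) • B F u v := by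
  have hc : d * c = c * d := mul_comm d c
  apply Mbig_ext <;>
  simp only [B, Prod.smul_fst, Prod.smul_snd, pair1_smul, pair2_smul, pair3_smul, actT_smul,
    coactT_smul, wedgeT_smul, hc, smul_sub, smul_add, Matrix.smul_mul, Matrix.mul_smul,
    smul_smul]

/-! ### The automorphisms preserve the bracket -/

lemma phi1_B {ω : F} (h3 : ω ^ 3 = 1) (u v : Mbig F) :
    phi1 F ω (B F u v) = B F (phi1 F ω u) (phi1 F ω v) := by
  have e1 : ω ^ 2 * ω = 1 := by rw [← h3]; ring
  have e2 : ω ^ 2 * ω ^ 2 = ω := by linear_combination ω * h3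
  have e3 : ω * ω = ω ^ 2 := by ring
  have a1 : ∀ (d : F) (g : gl3 F × gl3 F × gl3 F) (x : T3 F),
    actT F g (d • x) = d • actT F g x := fun d g x => by
      have := actT_smul 1 d g x
      rwa [one_smul, one_mul] at this
  have a2 : ∀ (d : F) (g : gl3 F × gl3 F × gl3 F) (x : T3 F),
    coactT F g (d • x) = d • coactT F g x := fun d g x => by
      have := coactT_smul 1 d g x
      rwa [one_smul, one_mul] at this
  apply Mbig_ext <;>
  simp only [phi1, B, LinearMap.coe_mk, AddHom.coe_mk, pair1_smul, pair2_smul, pair3_smul,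
    wedgeT_smul, a1, a2, e1, e2, e3, one_smul, smul_sub, smul_add]

lemma sum_sub_one (f : Fin 3 → F) : ∑ i, f (i - 1) = ∑ i, f i :=
  (Equiv.subRight (1 : Fin 3)).sum_comp f

lemma eps_table (a b c : Fin 3) : eps F a b c =
    if b = a + 1 ∧ c = a + 2 then 1 else if b = a + 2 ∧ c = a + 1 then -1 else 0 := by
  fin_cases a <;> fin_cases b <;> fin_cases c <;>
    simp [eps, det3, Matrix.det_fin_three]

lemma eps_shift (a b c : Fin 3) : eps F (a - 1) (b - 1) (c - 1) = eps F a b c := by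
  have h1 : (b - 1 = a - 1 + 1 ∧ c - 1 = a - 1 + 2) ↔ (b = a + 1 ∧ c = a + 2) := by
    revert a b c; decide
  have h2 : (b - 1 = a - 1 + 2 ∧ c - 1 = a - 1 + 1) ↔ (b = a + 2 ∧ c = a + 1) := by
    revert a b c; decide
  simp only [eps_table, h1, h2]

lemma eps_sum (a b c : Fin 3) (h : eps F a b c ≠ 0) : a + b + c = 0 := by
  rw [eps_table] at h
  split_ifs at h with h1 h2
  · rw [h1.1, h1.2]; clear h1 h; revert a; decide
  · rw [h2.1, h2.2]; clear h1 h2 h; revert a; decide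
  · exact absurd rfl h

lemma eps_W {ω : F} (h3 : ω ^ 3 = 1) (a b c : Fin 3) :
    W3 ω a * W3 ω b * eps F a b c = W3 ω (-c) * eps F a b c := by
  by_cases h : eps F a b c = 0
  · rw [h]; ring
  · rw [← W3_add h3, show a + b = -c from eq_neg_of_add_eq_zero_left (eps_sum a b c h)]

lemma sum_shift {f g : Fin 3 → F} (h : ∀ i, f i = g (i - 1)) : ∑ i, f i = ∑ i, g i := by
  rw [← sum_sub_one g]
  exact Finset.sum_congr rfl fun i _ => h i

/-- Coordinate shift of a tensor. -/
def shT (x : T3 F) : T3 F := fun i j k => x (i - 1) (j - 1) (k - 1)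

/-- Coordinate shift of a matrix. -/
def shM (x : gl3 F) : gl3 F := fun i j => x (i - 1) (j - 1)

lemma wedgeT_shT (x y : T3 F) : wedgeT F (shT x) (shT y) = shT (wedgeT F x y) := by
  refine T3_ext fun c d e => ?_
  simp only [wedgeT, shT]
  refine sum_shift fun i => ?_
  refine sum_shift fun j => ?_
  refine sum_shift fun k => ?_
  refine sum_shift fun l => ?_
  refine sum_shift fun m => ?_
  refine sum_shift fun n => ?_
  rw [← eps_shift i l c, ← eps_shift j m d, ← eps_shift k n e]

lemma actT_shT (g₁ g₂ g₃ : gl3 F) (x : T3 F) :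
    actT F (shM g₁, shM g₂, shM g₃) (shT x) = shT (actT F (g₁, g₂, g₃) x) := by
  refine T3_ext fun i j k => ?_
  simp only [actT, shT, shM]
  refine congrArg₂ _ (congrArg₂ _ ?_ ?_) ?_ <;> exact sum_shift fun a => rfl

lemma coactT_shT (g₁ g₂ g₃ : gl3 F) (x : T3 F) :
    coactT F (shM g₁, shM g₂, shM g₃) (shT x) = shT (coactT F (g₁, g₂, g₃) x) := by
  refine T3_ext fun i j k => ?_
  simp only [coactT, shT, shM]
  refine congrArg _ (congrArg₂ _ (congrArg₂ _ ?_ ?_) ?_) <;> exact sum_shift fun a => rfl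

lemma tpair_shT (f x : T3 F) : tpair F (shT f) (shT x) = tpair F f x :=
  sum_shift fun _ => sum_shift fun _ => sum_shift fun _ => rfl

lemma pair1_shT (f x : T3 F) : pair1 F (shT f) (shT x) = shM (pair1 F f x) := by
  ext r s
  simp only [pair1, shM, Matrix.of_apply, tpair_shT, sub_left_inj]
  exact sum_shift fun _ => sum_shift fun _ => rfl

lemma pair2_shT (f x : T3 F) : pair2 F (shT f) (shT x) = shM (pair2 F f x) := by
  ext r s
  simp only [pair2, shM, Matrix.of_apply, tpair_shT, sub_left_inj]
  exact sum_shift fun _ => sum_shift fun _ => rfl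

lemma pair3_shT (f x : T3 F) : pair3 F (shT f) (shT x) = shM (pair3 F f x) := by
  ext r s
  simp only [pair3, shM, Matrix.of_apply, tpair_shT, sub_left_inj]
  exact sum_shift fun _ => sum_shift fun _ => rfl

lemma mul_shM (a b : gl3 F) : shM a * shM b = shM (a * b) := by
  ext r s
  simp only [Matrix.mul_apply, shM]
  exact sum_shift fun _ => rfl

lemma phi2_eq (u : Mbig F) :
    phi2 F u = ((shM u.1.1, shM u.1.2.1, shM u.1.2.2), (shT u.2.1, shT u.2.2)) := by
  apply Mbig_ext
  · ext r s; exact Pconj_apply _ r s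
  · ext r s; exact Pconj_apply _ r s
  · ext r s; exact Pconj_apply _ r s
  · rfl
  · rfl

lemma phi2_B (u v : Mbig F) : phi2 F (B F u v) = B F (phi2 F u) (phi2 F v) := by
  simp only [phi2_eq]
  apply Mbig_ext <;>
  simp only [B, mul_shM, pair1_shT, pair2_shT, pair3_shT, actT_shT, coactT_shT,
    wedgeT_shT] <;> rfl

/-- The diagonal action on `L₁`. -/
def dgT (ω : F) (x : T3 F) : T3 F := fun i j k => W3 ω i * W3 ω j * W3 ω k * x i j k

/-- The diagonal action on `L₂`. -/
def dgN (ω : F) (x : T3 F) : T3 F := fun i j k => W3 ω (-i) * W3 ω (-j) * W3 ω (-k) * x i j k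

/-- The diagonal action on matrices. -/
def dgM (ω : F) (x : gl3 F) : gl3 F := fun i j => W3 ω i * W3 ω (-j) * x i j

lemma phi3_eq {ω : F} (h3 : ω ^ 3 = 1) (u : Mbig F) :
    phi3 F ω u = ((dgM ω u.1.1, dgM ω u.1.2.1, dgM ω u.1.2.2), (dgT ω u.2.1, dgN ω u.2.2)) := by
  apply Mbig_ext
  · ext r s; exact Dconj_apply _ r s
  · ext r s; exact Dconj_apply _ r s
  · ext r s; exact Dconj_apply _ r s
  · refine T3_ext fun i j k => ?_
    simp only [phi3, LinearMap.coe_mk, AddHom.coe_mk, dgT, W3_sum3 h3, W3_add h3]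
  · refine T3_ext fun i j k => ?_
    simp only [phi3, LinearMap.coe_mk, AddHom.coe_mk, dgN, W3_sum3' h3, neg_add, W3_add h3]

lemma eps_W' {ω : F} (h3 : ω ^ 3 = 1) (a b c : Fin 3) :
    W3 ω (-a) * W3 ω (-b) * eps F a b c = W3 ω c * eps F a b c := by
  by_cases h : eps F a b c = 0
  · rw [h]; ring
  · rw [← W3_add h3, show -a + -b = c by
      have := eps_sum a b c h
      clear h
      revert a b c
      decide]

lemma wedgeT_dgT {ω : F} (h3 : ω ^ 3 = 1) (x y : T3 F) :
    wedgeT F (dgT ω x) (dgT ω y) = dgN ω (wedgeT F x y) := by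
  refine T3_ext fun c d e => ?_
  simp only [wedgeT, dgT, dgN, Finset.mul_sum]
  refine Finset.sum_congr rfl fun i _ => Finset.sum_congr rfl fun j _ =>
    Finset.sum_congr rfl fun k _ => Finset.sum_congr rfl fun l _ =>
    Finset.sum_congr rfl fun m _ => Finset.sum_congr rfl fun n _ => ?_
  calc _ = x i j k * y l m n * (W3 ω i * W3 ω l * eps F i l c) *
        (W3 ω j * W3 ω m * eps F j m d) * (W3 ω k * W3 ω n * eps F k n e) := by ring
    _ = _ := by rw [eps_W h3, eps_W h3, eps_W h3]; ring

lemma wedgeT_dgN {ω : F} (h3 : ω ^ 3 = 1) (x y : T3 F) :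
    wedgeT F (dgN ω x) (dgN ω y) = dgT ω (wedgeT F x y) := by
  refine T3_ext fun c d e => ?_
  simp only [wedgeT, dgT, dgN, Finset.mul_sum]
  refine Finset.sum_congr rfl fun i _ => Finset.sum_congr rfl fun j _ =>
    Finset.sum_congr rfl fun k _ => Finset.sum_congr rfl fun l _ =>
    Finset.sum_congr rfl fun m _ => Finset.sum_congr rfl fun n _ => ?_
  calc _ = x i j k * y l m n * (W3 ω (-i) * W3 ω (-l) * eps F i l c) *
        (W3 ω (-j) * W3 ω (-m) * eps F j m d) * (W3 ω (-k) * W3 ω (-n) * eps F k n e) := by ring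
    _ = _ := by rw [eps_W' h3, eps_W' h3, eps_W' h3]; ring

lemma actT_dg {ω : F} (h3 : ω ^ 3 = 1) (g₁ g₂ g₃ : gl3 F) (x : T3 F) :
    actT F (dgM ω g₁, dgM ω g₂, dgM ω g₃) (dgT ω x) = dgT ω (actT F (g₁, g₂, g₃) x) := by
  refine T3_ext fun i j k => ?_
  simp only [actT, dgT, dgM, mul_add, Finset.mul_sum]
  refine congrArg₂ _ (congrArg₂ _ ?_ ?_) ?_ <;> refine Finset.sum_congr rfl fun a _ => ?_
  · linear_combination W3 ω i * W3 ω j * W3 ω k * g₁ i a * x a j k * W3_neg h3 a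
  · linear_combination W3 ω i * W3 ω j * W3 ω k * g₂ j a * x i a k * W3_neg h3 a
  · linear_combination W3 ω i * W3 ω j * W3 ω k * g₃ k a * x i j a * W3_neg h3 a

lemma coactT_dg {ω : F} (h3 : ω ^ 3 = 1) (g₁ g₂ g₃ : gl3 F) (x : T3 F) :
    coactT F (dgM ω g₁, dgM ω g₂, dgM ω g₃) (dgN ω x) = dgN ω (coactT F (g₁, g₂, g₃) x) := by
  refine T3_ext fun i j k => ?_
  simp only [coactT, dgN, dgM, mul_add, mul_neg, Finset.mul_sum]
  refine congrArg _ (congrArg₂ _ (congrArg₂ _ ?_ ?_) ?_) <;>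
    refine Finset.sum_congr rfl fun a _ => ?_
  · linear_combination W3 ω (-i) * W3 ω (-j) * W3 ω (-k) * g₁ a i * x a j k * W3_neg h3 a
  · linear_combination W3 ω (-i) * W3 ω (-j) * W3 ω (-k) * g₂ a j * x i a k * W3_neg h3 a
  · linear_combination W3 ω (-i) * W3 ω (-j) * W3 ω (-k) * g₃ a k * x i j a * W3_neg h3 a

lemma tpair_dg {ω : F} (h3 : ω ^ 3 = 1) (f x : T3 F) :
    tpair F (dgN ω f) (dgT ω x) = tpair F f x := by
  refine Finset.sum_congr rfl fun i _ => Finset.sum_congr rfl fun j _ =>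
    Finset.sum_congr rfl fun k _ => ?_
  calc _ = (W3 ω (-i) * W3 ω i) * (W3 ω (-j) * W3 ω j) * (W3 ω (-k) * W3 ω k)
        * (f i j k * x i j k) := by simp only [dgN, dgT]; ring
    _ = _ := by simp only [W3_neg h3, one_mul]

lemma diag_dg {ω : F} (h3 : ω ^ 3 = 1) (r s : Fin 3) (t : F) :
    (1 / 3 : F) * (if r = s then t else 0)
      = W3 ω r * W3 ω (-s) * ((1 / 3 : F) * (if r = s then t else 0)) := by
  split_ifs with h
  · subst h
    linear_combination -(1 / 3 : F) * t * W3_neg h3 r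
  · ring

lemma pair1_dg {ω : F} (h3 : ω ^ 3 = 1) (f x : T3 F) :
    pair1 F (dgN ω f) (dgT ω x) = dgM ω (pair1 F f x) := by
  ext r s
  simp only [pair1, dgM, Matrix.of_apply, tpair_dg h3, mul_sub]
  rw [← diag_dg h3]
  refine congrArg₂ _ ?_ rfl
  simp only [Finset.mul_sum]
  refine Finset.sum_congr rfl fun j _ => Finset.sum_congr rfl fun k _ => ?_
  calc _ = (W3 ω (-j) * W3 ω j) * (W3 ω (-k) * W3 ω k)
        * (W3 ω r * W3 ω (-s) * (f s j k * x r j k)) := by simp only [dgN, dgT]; ring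
    _ = _ := by simp only [W3_neg h3, one_mul]

lemma pair2_dg {ω : F} (h3 : ω ^ 3 = 1) (f x : T3 F) :
    pair2 F (dgN ω f) (dgT ω x) = dgM ω (pair2 F f x) := by
  ext r s
  simp only [pair2, dgM, Matrix.of_apply, tpair_dg h3, mul_sub]
  rw [← diag_dg h3]
  refine congrArg₂ _ ?_ rfl
  simp only [Finset.mul_sum]
  refine Finset.sum_congr rfl fun j _ => Finset.sum_congr rfl fun k _ => ?_
  calc _ = (W3 ω (-j) * W3 ω j) * (W3 ω (-k) * W3 ω k)
        * (W3 ω r * W3 ω (-s) * (f j s k * x j r k)) := by simp only [dgN, dgT]; ring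
    _ = _ := by simp only [W3_neg h3, one_mul]

lemma pair3_dg {ω : F} (h3 : ω ^ 3 = 1) (f x : T3 F) :
    pair3 F (dgN ω f) (dgT ω x) = dgM ω (pair3 F f x) := by
  ext r s
  simp only [pair3, dgM, Matrix.of_apply, tpair_dg h3, mul_sub]
  rw [← diag_dg h3]
  refine congrArg₂ _ ?_ rfl
  simp only [Finset.mul_sum]
  refine Finset.sum_congr rfl fun j _ => Finset.sum_congr rfl fun k _ => ?_
  calc _ = (W3 ω (-j) * W3 ω j) * (W3 ω (-k) * W3 ω k)
        * (W3 ω r * W3 ω (-s) * (f j k s * x j k r)) := by simp only [dgN, dgT]; ring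
    _ = _ := by simp only [W3_neg h3, one_mul]

lemma mul_dgM {ω : F} (h3 : ω ^ 3 = 1) (a b : gl3 F) : dgM ω a * dgM ω b = dgM ω (a * b) := by
  ext r s
  simp only [Matrix.mul_apply, dgM, Finset.mul_sum]
  refine Finset.sum_congr rfl fun j _ => ?_
  linear_combination W3 ω r * W3 ω (-s) * a r j * b j s * W3_neg h3 j

lemma dgM_lin (ω : F) (a b c d : gl3 F) :
    dgM ω a - dgM ω b + dgM ω c - dgM ω d = dgM ω (a - b + c - d) := by
  ext r s
  simp only [dgM, Matrix.sub_apply, Matrix.add_apply]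
  ring

lemma dgT_lin (ω : F) (a b c : T3 F) :
    dgT ω a - dgT ω b + dgT ω c = dgT ω (a - b + c) := by
  refine T3_ext fun i j k => ?_
  simp only [dgT, Pi.sub_apply, Pi.add_apply]
  ring

lemma dgN_lin (ω : F) (a b c : T3 F) :
    dgN ω a - dgN ω b + dgN ω c = dgN ω (a - b + c) := by
  refine T3_ext fun i j k => ?_
  simp only [dgN, Pi.sub_apply, Pi.add_apply]
  ring

lemma phi3_B {ω : F} (h3 : ω ^ 3 = 1) (u v : Mbig F) :
    phi3 F ω (B F u v) = B F (phi3 F ω u) (phi3 F ω v) := by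
  simp only [phi3_eq h3]
  apply Mbig_ext <;>
  simp only [B, mul_dgM h3, pair1_dg h3, pair2_dg h3, pair3_dg h3, actT_dg h3, coactT_dg h3,
    wedgeT_dgT h3, wedgeT_dgN h3, dgM_lin, dgT_lin, dgN_lin]

/-- Exchange of the last two tensor factors. -/
def swT (x : T3 F) : T3 F := fun i j k => x i k j

lemma wedgeT_sw (x y : T3 F) : wedgeT F (swT x) (swT y) = swT (wedgeT F x y) := by
  refine T3_ext fun c d e => ?_
  simp only [wedgeT, swT]
  refine Finset.sum_congr rfl fun i _ => ?_
  rw [Finset.sum_comm]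
  refine Finset.sum_congr rfl fun j _ => Finset.sum_congr rfl fun k _ =>
    Finset.sum_congr rfl fun l _ => ?_
  rw [Finset.sum_comm]
  refine Finset.sum_congr rfl fun m _ => Finset.sum_congr rfl fun n _ => ?_
  ring

lemma actT_sw (g₁ g₂ g₃ : gl3 F) (x : T3 F) :
    actT F (g₁, g₃, g₂) (swT x) = swT (actT F (g₁, g₂, g₃) x) := by
  refine T3_ext fun c d e => ?_
  simp only [actT, swT]
  ring

lemma coactT_sw (g₁ g₂ g₃ : gl3 F) (x : T3 F) :
    coactT F (g₁, g₃, g₂) (swT x) = swT (coactT F (g₁, g₂, g₃) x) := by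
  refine T3_ext fun c d e => ?_
  simp only [coactT, swT]
  ring

lemma tpair_sw (f x : T3 F) : tpair F (swT f) (swT x) = tpair F f x :=
  Finset.sum_congr rfl fun _ _ => Finset.sum_comm

lemma pair1_sw (f x : T3 F) : pair1 F (swT f) (swT x) = pair1 F f x := by
  ext r s
  simp only [pair1, Matrix.of_apply, tpair_sw]
  exact congrArg₂ _ Finset.sum_comm rfl

lemma pair2_sw (f x : T3 F) : pair2 F (swT f) (swT x) = pair3 F f x := by
  ext r s
  simp only [pair2, pair3, Matrix.of_apply, tpair_sw]
  rfl

lemma pair3_sw (f x : T3 F) : pair3 F (swT f) (swT x) = pair2 F f x := by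
  ext r s
  simp only [pair2, pair3, Matrix.of_apply, tpair_sw]
  rfl

lemma tau_eq (u : Mbig F) :
    tau F u = ((u.1.1, u.1.2.2, u.1.2.1), (swT u.2.1, swT u.2.2)) := rfl

lemma tau_B (u v : Mbig F) : tau F (B F u v) = B F (tau F u) (tau F v) := by
  simp only [tau_eq]
  apply Mbig_ext <;>
  simp only [B, pair1_sw, pair2_sw, pair3_sw, actT_sw, coactT_sw, wedgeT_sw] <;> rfl

lemma phi1_tau (ω : F) (u : Mbig F) : phi1 F ω (tau F u) = tau F (phi1 F ω u) := rfl
lemma phi2_tau (u : Mbig F) : phi2 F (tau F u) = tau F (phi2 F u) := rfl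
lemma phi3_tau {ω : F} (h3 : ω ^ 3 = 1) (u : Mbig F) :
    phi3 F ω (tau F u) = tau F (phi3 F ω u) := by
  simp only [phi3_eq h3, tau_eq]
  apply Mbig_ext <;> simp only
  all_goals
    refine T3_ext fun i j k => ?_
    simp only [dgT, dgN, swT]
    ring

/-! ### Joint eigenspaces of commuting operators of order three -/

lemma isInternal_of_proj {ι V : Type*} [Fintype ι] [DecidableEq ι] [AddCommGroup V] [Module F V]
    (S : ι → Submodule F V) (E : ι → V →ₗ[F] V) (h1 : ∀ g x, E g x ∈ S g)
    (h2 : ∀ g x, x ∈ S g → E g x = x) (h3 : ∀ g h x, g ≠ h → x ∈ S g → E h x = 0)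
    (h4 : ∀ x, ∑ g, E g x = x) : DirectSum.IsInternal S := by
  rw [DirectSum.isInternal_submodule_iff_iSupIndep_and_iSup_eq_top]
  constructor
  · rw [iSupIndep_def]
    intro i
    rw [Submodule.disjoint_def]
    intro x hx hx'
    have hle : (⨆ j, ⨆ (_ : j ≠ i), S j) ≤ LinearMap.ker (E i) :=
      iSup_le fun j => iSup_le fun hj => fun y hy => h3 j i y hj hy
    rw [← h2 i x hx]
    exact hle hx'
  · rw [eq_top_iff]
    intro x _
    rw [← h4 x]
    exact Submodule.sum_mem _ fun g _ => Submodule.mem_iSup_of_mem g (h1 g x)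

lemma W3_sum_eq {ω : F} (hω : IsPrimitiveRoot ω 3) (d : Fin 3) (hd : d ≠ 0) :
    1 + W3 ω d + W3 ω (-d) = 0 := by
  have h := hω.geom_sum_eq_zero (by norm_num)
  rw [Finset.sum_range_succ, Finset.sum_range_succ, Finset.sum_range_one] at h
  have hd' : d = 1 ∨ d = 2 := by revert d; decide
  rcases hd' with rfl | rfl
  · rw [show (-1 : Fin 3) = 2 from rfl]
    simpa [W3] using h
  · rw [show (-2 : Fin 3) = 1 from rfl]
    simp only [W3, Fin.val_one, Fin.val_two, pow_zero] at h ⊢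
    linear_combination h

section proj
variable {V : Type*} [AddCommGroup V] [Module F V]

/-- The projection onto the `ω^a`-eigenspace of an operator of order three. -/
def pr (ω : F) (φ : V →ₗ[F] V) (a : Fin 3) : V →ₗ[F] V :=
  (1 / 3 : F) • (LinearMap.id + W3 ω (-a) • φ + W3 ω a • (φ ∘ₗ φ))

lemma pr_apply (ω : F) (φ : V →ₗ[F] V) (a : Fin 3) (x : V) :
    pr ω φ a x = (1 / 3 : F) • (x + W3 ω (-a) • φ x + W3 ω a • φ (φ x)) := rfl

lemma pr_comm (ω : F) (φ ψ : V →ₗ[F] V) (h : ∀ x, ψ (φ x) = φ (ψ x)) (a : Fin 3) (x : V) :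
    ψ (pr ω φ a x) = pr ω φ a (ψ x) := by
  simp only [pr_apply, map_smul, map_add, h]

lemma pr_eig {ω : F} (h3 : ω ^ 3 = 1) (φ : V →ₗ[F] V) (h : ∀ x, φ (φ (φ x)) = x) (a : Fin 3)
    (x : V) : φ (pr ω φ a x) = W3 ω a • pr ω φ a x := by
  have e1 : W3 ω a * W3 ω (-a) = 1 := by rw [mul_comm]; exact W3_neg h3 a
  have e2 : W3 ω a * W3 ω a = W3 ω (-a) := by
    rw [← W3_add h3]; congr 1; clear e1; revert a; decide
  simp only [pr_apply, map_smul, map_add, h, smul_add, smul_smul]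
  rw [show W3 ω a * (1 / 3 * W3 ω (-a)) = 1 / 3 * (W3 ω a * W3 ω (-a)) by ring, e1,
    show W3 ω a * (1 / 3 * W3 ω a) = 1 / 3 * (W3 ω a * W3 ω a) by ring, e2,
    mul_comm (W3 ω a) (1 / 3), mul_one]
  abel

lemma pr_of_eig {ω : F} (hω : IsPrimitiveRoot ω 3) (φ : V →ₗ[F] V) (a b : Fin 3)
    (x : V) (hx : φ x = W3 ω b • x) : pr ω φ a x = if a = b then x else 0 := by
  have h3 := hω.pow_eq_one
  have e : pr ω φ a x = ((1 / 3 : F) * (1 + W3 ω (b - a) + W3 ω (-(b - a)))) • x := by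
    have e1 : W3 ω (b - a) = W3 ω (-a) * W3 ω b := by
      rw [← W3_add h3]; congr 1; abel
    have e2 : W3 ω (-(b - a)) = W3 ω a * (W3 ω b * W3 ω b) := by
      rw [← W3_add h3, ← W3_add h3]; congr 1; clear e1 hx; revert a b; decide
    simp only [pr_apply, hx, map_smul, smul_smul, smul_add, e1, e2, mul_add, add_smul, mul_one]
  rw [e]
  split_ifs with h
  · subst h
    rw [sub_self, neg_zero, W3_zero]
    norm_num
  · rw [W3_sum_eq hω _ (sub_ne_zero.mpr (Ne.symm h)), mul_zero, zero_smul]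

lemma pr_sum {ω : F} (hω : IsPrimitiveRoot ω 3) (φ : V →ₗ[F] V) (x : V) :
    ∑ a, pr ω φ a x = x := by
  have e := W3_sum_eq hω 1 (by decide)
  rw [show (-1 : Fin 3) = 2 from rfl] at e
  rw [Fin.sum_univ_three]
  simp only [pr_apply, show (-1 : Fin 3) = 2 from rfl, show (-2 : Fin 3) = 1 from rfl, neg_zero,
    W3_zero]
  calc _ = ((1 / 3 : F) * 3) • x + ((1 / 3 : F) * (1 + W3 ω 1 + W3 ω 2)) • φ x
        + ((1 / 3 : F) * (1 + W3 ω 1 + W3 ω 2)) • φ (φ x) := by module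
    _ = x := by rw [e]; norm_num

lemma joint_isInternal {ι : Type*} [Fintype ι] [DecidableEq ι]
    (d : ι ≃ Fin 3 × Fin 3 × Fin 3) {ω : F} (hω : IsPrimitiveRoot ω 3) (φ₁ φ₂ φ₃ : V →ₗ[F] V)
    (c₁ : ∀ x, φ₁ (φ₁ (φ₁ x)) = x) (c₂ : ∀ x, φ₂ (φ₂ (φ₂ x)) = x)
    (c₃ : ∀ x, φ₃ (φ₃ (φ₃ x)) = x) (h12 : ∀ x, φ₁ (φ₂ x) = φ₂ (φ₁ x))
    (h13 : ∀ x, φ₁ (φ₃ x) = φ₃ (φ₁ x)) (h23 : ∀ x, φ₂ (φ₃ x) = φ₃ (φ₂ x))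
    (S : ι → Submodule F V)
    (hS : ∀ g x, x ∈ S g ↔ φ₁ x = W3 ω (d g).1 • x ∧ φ₂ x = W3 ω (d g).2.1 • x ∧
      φ₃ x = W3 ω (d g).2.2 • x) : DirectSum.IsInternal S := by
  have h3 := hω.pow_eq_one
  refine isInternal_of_proj S
    (fun g => pr ω φ₁ (d g).1 ∘ₗ pr ω φ₂ (d g).2.1 ∘ₗ pr ω φ₃ (d g).2.2) ?_ ?_ ?_ ?_
  · intro g x
    rw [hS]
    simp only [LinearMap.comp_apply]
    refine ⟨pr_eig h3 _ c₁ _ _, ?_, ?_⟩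
    · rw [pr_comm ω φ₁ φ₂ (fun x => (h12 x).symm), pr_eig h3 _ c₂, map_smul]
    · rw [pr_comm ω φ₁ φ₃ (fun x => (h13 x).symm), pr_comm ω φ₂ φ₃ (fun x => (h23 x).symm),
        pr_eig h3 _ c₃, map_smul, map_smul]
  · intro g x hx
    obtain ⟨e1, e2, e3⟩ := (hS g x).1 hx
    simp only [LinearMap.comp_apply]
    rw [pr_of_eig hω _ _ _ _ e3, if_pos rfl, pr_of_eig hω _ _ _ _ e2, if_pos rfl,
      pr_of_eig hω _ _ _ _ e1, if_pos rfl]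
  · intro g h x hgh hx
    obtain ⟨e1, e2, e3⟩ := (hS g x).1 hx
    simp only [LinearMap.comp_apply]
    rw [pr_of_eig hω _ _ _ _ e3]
    split_ifs with k3
    · rw [pr_of_eig hω _ _ _ _ e2]
      split_ifs with k2
      · rw [pr_of_eig hω _ _ _ _ e1]
        split_ifs with k1
        · exact absurd (d.injective (Prod.ext k1 (Prod.ext k2 k3))).symm hgh
        · rfl
      · rw [map_zero]
    · rw [map_zero, map_zero]
  · intro x
    refine (Equiv.sum_comp d (fun g => (pr ω φ₁ g.1 ∘ₗ pr ω φ₂ g.2.1 ∘ₗ pr ω φ₃ g.2.2) x)).trans ?_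
    simp only [LinearMap.comp_apply, Fintype.sum_prod_type]
    simp only [← map_sum, pr_sum hω]

end proj

/-- Restriction of an endomorphism of the ambient space to `L^τ`. -/
def resT (φ : Mbig F →ₗ[F] Mbig F)
    (h : ∀ u, u ∈ Lsub F → tau F u = u → φ u ∈ Lsub F ∧ tau F (φ u) = φ u) :
    ↥(Ltau F) →ₗ[F] ↥(Ltau F) where
  toFun u := ⟨⟨φ u.1.1, (h u.1.1 u.1.2 (sub_eq_zero.1 u.2)).1⟩,
    sub_eq_zero.2 (h u.1.1 u.1.2 (sub_eq_zero.1 u.2)).2⟩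
  map_add' u v := by
    apply Subtype.ext; apply Subtype.ext; exact map_add φ _ _
  map_smul' c u := by
    apply Subtype.ext; apply Subtype.ext; exact map_smul φ c _

lemma resT_cube (φ : Mbig F →ₗ[F] Mbig F) (h) (hc : ∀ u, φ (φ (φ u)) = u) (x : ↥(Ltau F)) :
    resT φ h (resT φ h (resT φ h x)) = x := Subtype.ext (Subtype.ext (hc x.1.1))

lemma resT_comm (φ ψ : Mbig F →ₗ[F] Mbig F) (h h') (hc : ∀ u, φ (ψ u) = ψ (φ u))
    (x : ↥(Ltau F)) : resT φ h (resT ψ h' x) = resT ψ h' (resT φ h x) :=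
  Subtype.ext (Subtype.ext (hc x.1.1))

lemma resT_eig (φ : Mbig F →ₗ[F] Mbig F) (h) (r : F) (x : ↥(Ltau F)) :
    φ x.1.1 = r • x.1.1 ↔ resT φ h x = r • x :=
  ⟨fun e => Subtype.ext (Subtype.ext e), fun e => congrArg (fun y => y.1.1) e⟩

lemma mem_Lsub (u : Mbig F) : u ∈ Lsub F ↔ Matrix.trace u.1.1 = 0 ∧ Matrix.trace u.1.2.1 = 0 ∧
    Matrix.trace u.1.2.2 = 0 := by
  constructor
  · rintro ⟨⟨h1, h2, h3⟩, -⟩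
    exact ⟨h1, h2, h3⟩
  · rintro ⟨h1, h2, h3⟩
    exact ⟨⟨h1, h2, h3⟩, trivial, trivial⟩

lemma trace_shM (a : gl3 F) : Matrix.trace (shM a) = Matrix.trace a :=
  sum_shift fun _ => rfl

lemma trace_dgM {ω : F} (h3 : ω ^ 3 = 1) (a : gl3 F) :
    Matrix.trace (dgM ω a) = Matrix.trace a := by
  refine Finset.sum_congr rfl fun i _ => ?_
  simp only [Matrix.diag_apply, dgM]
  linear_combination a i i * W3_neg h3 i

lemma phi1_Lsub (ω : F) (u : Mbig F) (h : u ∈ Lsub F) : phi1 F ω u ∈ Lsub F := by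
  rw [mem_Lsub] at h ⊢
  exact h

lemma phi2_Lsub (u : Mbig F) (h : u ∈ Lsub F) : phi2 F u ∈ Lsub F := by
  rw [mem_Lsub] at h ⊢
  simpa only [phi2_eq, trace_shM] using h

lemma phi3_Lsub {ω : F} (h3 : ω ^ 3 = 1) (u : Mbig F) (h : u ∈ Lsub F) :
    phi3 F ω u ∈ Lsub F := by
  rw [mem_Lsub] at h ⊢
  simpa only [phi3_eq h3, trace_dgM h3] using h

lemma phi1_cube {ω : F} (h3 : ω ^ 3 = 1) (u : Mbig F) :
    phi1 F ω (phi1 F ω (phi1 F ω u)) = u := by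
  apply Mbig_ext
  · rfl
  · rfl
  · rfl
  · simp only [phi1, LinearMap.coe_mk, AddHom.coe_mk, smul_smul]
    rw [show ω * (ω * ω) = 1 by rw [← h3]; ring, one_smul]
  · simp only [phi1, LinearMap.coe_mk, AddHom.coe_mk, smul_smul]
    rw [show ω ^ 2 * (ω ^ 2 * ω ^ 2) = 1 by linear_combination (ω ^ 3 + 1) * h3, one_smul]

lemma sub_one_three (i : Fin 3) : i - 1 - 1 - 1 = i := by revert i; decide

lemma phi2_cube (u : Mbig F) : phi2 F (phi2 F (phi2 F u)) = u := by
  simp only [phi2_eq]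
  apply Mbig_ext
  · ext r s; simp only [shM, sub_one_three]
  · ext r s; simp only [shM, sub_one_three]
  · ext r s; simp only [shM, sub_one_three]
  · refine T3_ext fun i j k => ?_; simp only [shT, sub_one_three]
  · refine T3_ext fun i j k => ?_; simp only [shT, sub_one_three]

lemma W3_cube {ω : F} (h3 : ω ^ 3 = 1) (i : Fin 3) : W3 ω i ^ 3 = 1 := by
  rw [W3, ← pow_mul, mul_comm, pow_mul, h3, one_pow]

lemma dgM_cube {ω : F} (h3 : ω ^ 3 = 1) (a : gl3 F) : dgM ω (dgM ω (dgM ω a)) = a := by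
  ext r s
  calc _ = W3 ω r ^ 3 * W3 ω (-s) ^ 3 * a r s := by simp only [dgM]; ring
    _ = _ := by rw [W3_cube h3, W3_cube h3]; ring

lemma phi3_cube {ω : F} (h3 : ω ^ 3 = 1) (u : Mbig F) :
    phi3 F ω (phi3 F ω (phi3 F ω u)) = u := by
  simp only [phi3_eq h3, dgM_cube h3]
  apply Mbig_ext
  · rfl
  · rfl
  · rfl
  · refine T3_ext fun i j k => ?_
    calc _ = W3 ω i ^ 3 * W3 ω j ^ 3 * W3 ω k ^ 3 * u.2.1 i j k := by simp only [dgT]; ring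
      _ = _ := by rw [W3_cube h3, W3_cube h3, W3_cube h3]; ring
  · refine T3_ext fun i j k => ?_
    calc _ = W3 ω (-i) ^ 3 * W3 ω (-j) ^ 3 * W3 ω (-k) ^ 3 * u.2.2 i j k := by
          simp only [dgN]; ring
      _ = _ := by rw [W3_cube h3, W3_cube h3, W3_cube h3]; ring

lemma phi1_phi2 (ω : F) (u : Mbig F) : phi1 F ω (phi2 F u) = phi2 F (phi1 F ω u) := rfl

lemma phi1_phi3 (ω : F) (u : Mbig F) : phi1 F ω (phi3 F ω u) = phi3 F ω (phi1 F ω u) := by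
  apply Mbig_ext
  · rfl
  · rfl
  · rfl
  · refine T3_ext fun i j k => ?_
    simp only [phi1, phi3, LinearMap.coe_mk, AddHom.coe_mk, Pi.smul_apply, smul_eq_mul]
    ring
  · refine T3_ext fun i j k => ?_
    simp only [phi1, phi3, LinearMap.coe_mk, AddHom.coe_mk, Pi.smul_apply, smul_eq_mul]
    ring

lemma shM_dgM {ω : F} (h3 : ω ^ 3 = 1) (a : gl3 F) : shM (dgM ω a) = dgM ω (shM a) := by
  ext r s
  simp only [shM, dgM, ← W3_add h3]
  rw [show r - 1 + -(s - 1) = r + -s by abel]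

lemma phi2_phi3 {ω : F} (h3 : ω ^ 3 = 1) (u : Mbig F) :
    phi2 F (phi3 F ω u) = phi3 F ω (phi2 F u) := by
  simp only [phi3_eq h3, phi2_eq, shM_dgM h3]
  apply Mbig_ext
  · rfl
  · rfl
  · rfl
  · refine T3_ext fun i j k => ?_
    simp only [shT, dgT, ← W3_add h3]
    rw [show i - 1 + (j - 1) + (k - 1) = i + j + k by revert i j k; decide]
  · refine T3_ext fun i j k => ?_
    simp only [shT, dgN, ← W3_add h3]
    rw [show -(i - 1) + -(j - 1) + -(k - 1) = -i + -j + -k by revert i j k; decide]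

/-- Being a homogeneous `τ`-fixed element of degree `(a,b,c)`. -/
def Hg (ω : F) (a b c : Fin 3) (u : Mbig F) : Prop :=
  tau F u = u ∧ phi1 F ω u = W3 ω a • u ∧ phi2 F u = W3 ω b • u ∧ phi3 F ω u = W3 ω c • u

lemma mem_Ltau (u : ↥(Lsub F)) : u ∈ Ltau F ↔ tau F u.1 = u.1 :=
  ⟨fun h => sub_eq_zero.1 h, fun h => sub_eq_zero.2 h⟩

lemma mem_Lcomp (ω : F) (g : ZMod 3 × ZMod 3 × ZMod 3) (u : ↥(Lsub F)) :
    u ∈ Lcomp F ω g ↔ phi1 F ω u.1 = W3 ω g.1 • u.1 ∧ phi2 F u.1 = W3 ω g.2.1 • u.1 ∧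
      phi3 F ω u.1 = W3 ω g.2.2 • u.1 :=
  ⟨fun h => ⟨sub_eq_zero.1 h.1.1, sub_eq_zero.1 h.1.2, sub_eq_zero.1 h.2⟩,
   fun h => ⟨⟨sub_eq_zero.2 h.1, sub_eq_zero.2 h.2.1⟩, sub_eq_zero.2 h.2.2⟩⟩

lemma mem_inf (ω : F) (g : ZMod 3 × ZMod 3 × ZMod 3) (u : ↥(Lsub F)) :
    u ∈ Ltau F ⊓ Lcomp F ω g ↔ Hg ω g.1 g.2.1 g.2.2 u.1 := by
  rw [Submodule.mem_inf, mem_Ltau, mem_Lcomp]; rfl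

lemma Hg_B {ω : F} (h3 : ω ^ 3 = 1) {a b c a' b' c' : Fin 3} {u v : Mbig F}
    (hu : Hg ω a b c u) (hv : Hg ω a' b' c' v) :
    Hg ω (a + a') (b + b') (c + c') (B F u v) := by
  obtain ⟨t, h1, h2, h4⟩ := hu
  obtain ⟨t', h1', h2', h4'⟩ := hv
  refine ⟨?_, ?_, ?_, ?_⟩
  · rw [tau_B, t, t']
  · rw [phi1_B h3, h1, h1', B_smul, W3_add h3]
  · rw [phi2_B, h2, h2', B_smul, W3_add h3]
  · rw [phi3_B h3, h4, h4', B_smul, W3_add h3]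

lemma resT_phi1 (ω : F) (u : Mbig F) (h : u ∈ Lsub F) (t : tau F u = u) :
    phi1 F ω u ∈ Lsub F ∧ tau F (phi1 F ω u) = phi1 F ω u :=
  ⟨phi1_Lsub ω u h, by rw [← phi1_tau, t]⟩

lemma resT_phi2 (u : Mbig F) (h : u ∈ Lsub F) (t : tau F u = u) :
    phi2 F u ∈ Lsub F ∧ tau F (phi2 F u) = phi2 F u :=
  ⟨phi2_Lsub u h, by rw [← phi2_tau, t]⟩

lemma resT_phi3 {ω : F} (h3 : ω ^ 3 = 1) (u : Mbig F) (h : u ∈ Lsub F) (t : tau F u = u) :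
    phi3 F ω u ∈ Lsub F ∧ tau F (phi3 F ω u) = phi3 F ω u :=
  ⟨phi3_Lsub h3 u h, by rw [← phi3_tau h3, t]⟩

lemma mem_Lcomp_resT {ω : F} (h3 : ω ^ 3 = 1) (g : ZMod 3 × ZMod 3 × ZMod 3) (x : ↥(Ltau F)) :
    x ∈ Submodule.comap (Ltau F).subtype (Lcomp F ω g) ↔
      resT (phi1 F ω) (resT_phi1 ω) x = W3 ω g.1 • x ∧
      resT (phi2 F) resT_phi2 x = W3 ω g.2.1 • x ∧
      resT (phi3 F ω) (resT_phi3 h3) x = W3 ω g.2.2 • x := by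
  rw [Submodule.mem_comap]
  refine (mem_Lcomp ω g _).trans ?_
  exact and_congr (resT_eig _ _ _ _) (and_congr (resT_eig _ _ _ _) (resT_eig _ _ _ _))

/-- The identification of index sets. -/
def idx : ZMod 3 × ZMod 3 × ZMod 3 ≃ Fin 3 × Fin 3 × Fin 3 := Equiv.refl _

lemma Ltau_isInternal {ω : F} (hω : IsPrimitiveRoot ω 3) : DirectSum.IsInternal
    (fun g : ZMod 3 × ZMod 3 × ZMod 3 => Submodule.comap (Ltau F).subtype (Lcomp F ω g)) := by
  have h3 := hω.pow_eq_one
  have c1 := resT_cube _ (resT_phi1 ω) (phi1_cube h3)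
  have c2 := resT_cube (F := F) _ resT_phi2 phi2_cube
  have c3 := resT_cube _ (resT_phi3 h3) (phi3_cube h3)
  have h12 := resT_comm _ _ (resT_phi1 ω) resT_phi2 (phi1_phi2 ω)
  have h13 := resT_comm _ _ (resT_phi1 ω) (resT_phi3 h3) (phi1_phi3 ω)
  have h23 := resT_comm _ _ resT_phi2 (resT_phi3 h3) (phi2_phi3 h3)
  have hS := mem_Lcomp_resT h3
  have H := joint_isInternal (V := ↥(Ltau F)) idx hω _ _ _ c1 c2 c3 h12 h13 h23
  have H2 := H (fun g : ZMod 3 × ZMod 3 × ZMod 3 => Submodule.comap (Ltau F).subtype (Lcomp F ω g))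
  have H3 := H2 (fun g x => hS g x)
  exact H3

/-! ### Dimensions of the components -/

lemma finrank_two {V : Type*} [AddCommGroup V] [Module F V] (S : Submodule F V)
    (e : V →ₗ[F] F × F) (hi : ∀ u ∈ S, e u = 0 → u = 0)
    (hs : ∀ s t : F, ∃ u ∈ S, e u = (s, t)) : Module.finrank F ↥S = 2 := by
  have hb : Function.Bijective (e.domRestrict S) := by
    constructor
    · rw [← LinearMap.ker_eq_bot, LinearMap.ker_eq_bot']
      intro u hu
      exact Subtype.ext (hi u.1 u.2 hu)
    · rintro ⟨s, t⟩
      obtain ⟨u, hu, h⟩ := hs s t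
      exact ⟨⟨u, hu⟩, h⟩
  rw [(LinearEquiv.ofBijective _ hb).finrank_eq, Module.finrank_prod, Module.finrank_self]

lemma T_inj {ω : F} (h3 : ω ^ 3 = 1) (b c : Fin 3) (x : T3 F)
    (h2 : ∀ i j k, x (i - 1) (j - 1) (k - 1) = W3 ω b * x i j k)
    (hs : ∀ i j k, i + j + k ≠ c → x i j k = 0) (hsym : ∀ i j k, x i k j = x i j k)
    (e1 : x 0 (-c) (-c) = 0) (e2 : x 0 (-c + 1) (-c - 1) = 0) : x = 0 := by
  have hb := W3_ne_zero h3 b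
  have step : ∀ i, (∀ j k, x (i - 1) j k = 0) → ∀ j k, x i j k = 0 := by
    intro i hi j k
    have := h2 i j k
    rw [hi] at this
    exact (mul_eq_zero.1 this.symm).resolve_left hb
  have h0 : ∀ j k, x 0 j k = 0 := by
    intro j k
    by_cases h : 0 + j + k = c
    · have hh : ∀ c j k : Fin 3, 0 + j + k = c → (j = -c ∧ k = -c) ∨
        (j = -c + 1 ∧ k = -c - 1) ∨ (j = -c - 1 ∧ k = -c + 1) := by decide
      rcases hh c j k h with ⟨rfl, rfl⟩ | ⟨rfl, rfl⟩ | ⟨rfl, rfl⟩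
      · exact e1
      · exact e2
      · rw [← hsym]; exact e2
    · exact hs _ _ _ h
  have h1 : ∀ j k, x 1 j k = 0 := step 1 h0
  have h2' : ∀ j k, x 2 j k = 0 := step 2 h1
  refine T3_ext fun i j k => ?_
  have hi : i = 0 ∨ i = 1 ∨ i = 2 := by revert i; decide
  rcases hi with rfl | rfl | rfl
  · exact h0 j k
  · exact h1 j k
  · exact h2' j k

lemma T_surj {ω : F} (h3 : ω ^ 3 = 1) (b c : Fin 3) (s t : F) : ∃ x : T3 F,
    (∀ i j k, x (i - 1) (j - 1) (k - 1) = W3 ω b * x i j k) ∧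
    (∀ i j k, i + j + k ≠ c → x i j k = 0) ∧ (∀ i j k, x i k j = x i j k) ∧
    x 0 (-c) (-c) = s ∧ x 0 (-c + 1) (-c - 1) = t := by
  refine ⟨fun i j k => if i + j + k = c then W3 ω (-(b * i)) * (if j = k then s else t) else 0,
    ?_, ?_, ?_, ?_, ?_⟩
  · intro i j k
    have e1 : i - 1 + (j - 1) + (k - 1) = i + j + k := by revert i j k; decide
    have e2 : -(b * (i - 1)) = b + -(b * i) := by clear e1; revert b i; decide
    simp only [e1, e2, sub_left_inj, W3_add h3]
    split_ifs <;> ring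
  · intro i j k h
    exact if_neg h
  · intro i j k
    simp only [show i + k + j = i + j + k by abel, eq_comm (a := k) (b := j)]
  · have : 0 + -c + -c = c := by revert c; decide
    simp only [this, if_true, mul_zero, neg_zero, W3_zero, one_mul]
  · have e1 : 0 + (-c + 1) + (-c - 1) = c := by revert c; decide
    have e2 : -c + 1 ≠ -c - 1 := by clear e1; revert c; decide
    simp only [e1, if_true, if_neg e2, mul_zero, neg_zero, W3_zero, one_mul]

lemma M_inj {ω : F} (h3 : ω ^ 3 = 1) (b c : Fin 3) (x : gl3 F)
    (h2 : ∀ i j, x (i - 1) (j - 1) = W3 ω b * x i j)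
    (hs : ∀ i j, i - j ≠ c → x i j = 0) (e1 : x 0 (-c) = 0) : x = 0 := by
  have hb := W3_ne_zero h3 b
  have step : ∀ i, (∀ j, x (i - 1) j = 0) → ∀ j, x i j = 0 := by
    intro i hi j
    have := h2 i j
    rw [hi] at this
    exact (mul_eq_zero.1 this.symm).resolve_left hb
  have h0 : ∀ j, x 0 j = 0 := by
    intro j
    by_cases h : 0 - j = c
    · have : j = -c := by rw [← h]; abel
      rw [this]; exact e1
    · exact hs _ _ h
  have h1 : ∀ j, x 1 j = 0 := step 1 h0
  have h2' : ∀ j, x 2 j = 0 := step 2 h1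
  ext i j
  have hi : i = 0 ∨ i = 1 ∨ i = 2 := by revert i; decide
  rcases hi with rfl | rfl | rfl
  · exact h0 j
  · exact h1 j
  · exact h2' j

lemma M_surj {ω : F} (hω : IsPrimitiveRoot ω 3) (b c : Fin 3) (hbc : ¬ (b = 0 ∧ c = 0)) (s : F) :
    ∃ x : gl3 F, (∀ i j, x (i - 1) (j - 1) = W3 ω b * x i j) ∧
    (∀ i j, i - j ≠ c → x i j = 0) ∧ Matrix.trace x = 0 ∧ x 0 (-c) = s := by
  have h3 := hω.pow_eq_one
  refine ⟨fun i j => if i - j = c then W3 ω (-(b * i)) * s else 0, ?_, ?_, ?_, ?_⟩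
  · intro i j
    have e2 : -(b * (i - 1)) = b + -(b * i) := by clear hbc; revert b i; decide
    simp only [e2, sub_sub_sub_cancel_right, W3_add h3]
    split_ifs <;> ring
  · intro i j h
    exact if_neg h
  · show ∑ i : Fin 3, (if i - i = c then W3 ω (-(b * i)) * s else 0) = 0
    by_cases hc : c = 0
    · have hb : b ≠ 0 := fun h => hbc ⟨h, hc⟩
      subst hc
      simp only [sub_self, if_true, Fin.sum_univ_three]
      have e0 : -(b * 0) = 0 := by clear hb hbc; revert b; decide
      have e1 : -(b * 1) = -b := by rw [mul_one]
      have e2 : -(b * 2) = b := by clear hb hbc e0 e1; revert b; decide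
      rw [e0, e1, e2, W3_zero]
      linear_combination s * W3_sum_eq hω b hb
    · simp only [sub_self, if_neg (Ne.symm hc),
        Finset.sum_const_zero]
  · simp only [zero_sub, neg_neg, if_true, mul_zero, neg_zero, W3_zero, one_mul]

/-- The conditions on the matrix components of a homogeneous element. -/
lemma cond_M {ω : F} (hω : IsPrimitiveRoot ω 3) (b c : Fin 3) (x : gl3 F) :
    (shM x = W3 ω b • x ∧ dgM ω x = W3 ω c • x) ↔
    ((∀ i j, x (i - 1) (j - 1) = W3 ω b * x i j) ∧ (∀ i j, i - j ≠ c → x i j = 0)) := by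
  have h3 := hω.pow_eq_one
  refine and_congr ⟨fun h i j => congrFun (congrFun h i) j, fun h => ?_⟩ ⟨?_, ?_⟩
  · ext i j; exact h i j
  · intro h i j hij
    have h' : W3 ω i * W3 ω (-j) * x i j = W3 ω c * x i j := congrFun (congrFun h i) j
    rw [← W3_add h3, ← sub_eq_add_neg] at h'
    by_contra h0
    exact hij (W3_inj hω (mul_right_cancel₀ h0 h'))
  · intro h
    ext i j
    show W3 ω i * W3 ω (-j) * x i j = W3 ω c * x i j
    rw [← W3_add h3, ← sub_eq_add_neg]
    by_cases hij : i - j = c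
    · rw [hij]
    · rw [h i j hij, mul_zero, mul_zero]

lemma cond_sh (ω : F) (b : Fin 3) (x : T3 F) :
    shT x = W3 ω b • x ↔ ∀ i j k, x (i - 1) (j - 1) (k - 1) = W3 ω b * x i j k :=
  ⟨fun h i j k => congrFun (congrFun (congrFun h i) j) k, fun h => T3_ext h⟩

lemma cond_T {ω : F} (hω : IsPrimitiveRoot ω 3) (c : Fin 3) (x : T3 F) :
    dgT ω x = W3 ω c • x ↔ (∀ i j k, i + j + k ≠ c → x i j k = 0) := by
  have h3 := hω.pow_eq_one
  constructor
  · intro h i j k hij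
    have h' : W3 ω i * W3 ω j * W3 ω k * x i j k = W3 ω c * x i j k :=
      congrFun (congrFun (congrFun h i) j) k
    rw [← W3_add h3, ← W3_add h3] at h'
    by_contra h0
    exact hij (W3_inj hω (mul_right_cancel₀ h0 h'))
  · intro h
    refine T3_ext fun i j k => ?_
    show W3 ω i * W3 ω j * W3 ω k * x i j k = W3 ω c * x i j k
    rw [← W3_add h3, ← W3_add h3]
    by_cases hij : i + j + k = c
    · rw [hij]
    · rw [h i j k hij, mul_zero, mul_zero]

lemma cond_N {ω : F} (hω : IsPrimitiveRoot ω 3) (c : Fin 3) (x : T3 F) :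
    dgN ω x = W3 ω c • x ↔ (∀ i j k, i + j + k ≠ -c → x i j k = 0) := by
  have h3 := hω.pow_eq_one
  have e : ∀ i j k : Fin 3, -i + -j + -k = c ↔ i + j + k = -c := by
    revert c; decide
  constructor
  · intro h i j k hij
    have h' : W3 ω (-i) * W3 ω (-j) * W3 ω (-k) * x i j k = W3 ω c * x i j k :=
      congrFun (congrFun (congrFun h i) j) k
    rw [← W3_add h3, ← W3_add h3] at h'
    by_contra h0
    exact hij ((e i j k).1 (W3_inj hω (mul_right_cancel₀ h0 h')))
  · intro h
    refine T3_ext fun i j k => ?_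
    show W3 ω (-i) * W3 ω (-j) * W3 ω (-k) * x i j k = W3 ω c * x i j k
    rw [← W3_add h3, ← W3_add h3]
    by_cases hij : i + j + k = -c
    · rw [(e i j k).2 hij]
    · rw [h i j k hij, mul_zero, mul_zero]

lemma Hg_iff {ω : F} (h3 : ω ^ 3 = 1) (a b c : Fin 3) (M₁ M₂ M₃ : gl3 F) (x y : T3 F) :
    Hg ω a b c ((M₁, M₂, M₃), (x, y)) ↔
    (M₃ = M₂ ∧ M₂ = M₃ ∧ swT x = x ∧ swT y = y) ∧
    (M₁ = W3 ω a • M₁ ∧ M₂ = W3 ω a • M₂ ∧ M₃ = W3 ω a • M₃ ∧ ω • x = W3 ω a • x ∧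
      ω ^ 2 • y = W3 ω a • y) ∧
    (shM M₁ = W3 ω b • M₁ ∧ shM M₂ = W3 ω b • M₂ ∧ shM M₃ = W3 ω b • M₃ ∧
      shT x = W3 ω b • x ∧ shT y = W3 ω b • y) ∧
    (dgM ω M₁ = W3 ω c • M₁ ∧ dgM ω M₂ = W3 ω c • M₂ ∧ dgM ω M₃ = W3 ω c • M₃ ∧
      dgT ω x = W3 ω c • x ∧ dgN ω y = W3 ω c • y) := by
  rw [Hg, tau_eq, phi2_eq, phi3_eq h3]
  simp only [phi1, LinearMap.coe_mk, AddHom.coe_mk, Prod.smul_mk, Prod.mk.injEq, true_and,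
    and_assoc]

lemma smul_inj {V : Type*} [AddCommGroup V] [Module F V] {p q : F} (h : p ≠ q) {x : V}
    (hx : p • x = q • x) : x = 0 := by
  have : (p - q) • x = 0 := by rw [sub_smul, hx, sub_self]
  exact (smul_eq_zero.1 this).resolve_left (sub_ne_zero.2 h)

lemma W3_ne {ω : F} (hω : IsPrimitiveRoot ω 3) {i j : Fin 3} (h : i ≠ j) : W3 ω i ≠ W3 ω j :=
  fun e => h (W3_inj hω e)

lemma W3_one (ω : F) : W3 ω 1 = ω := by simp [W3]
lemma W3_two (ω : F) : W3 ω 2 = ω ^ 2 := by simp [W3]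

/-- Homogeneous elements of degree `(0,b,c)`. -/
lemma Hg_zero {ω : F} (hω : IsPrimitiveRoot ω 3) (b c : Fin 3) (M₁ M₂ M₃ : gl3 F) (x y : T3 F) :
    Hg ω 0 b c ((M₁, M₂, M₃), (x, y)) ↔
    x = 0 ∧ y = 0 ∧ M₃ = M₂ ∧
    ((∀ i j, M₁ (i - 1) (j - 1) = W3 ω b * M₁ i j) ∧ (∀ i j, i - j ≠ c → M₁ i j = 0)) ∧
    ((∀ i j, M₂ (i - 1) (j - 1) = W3 ω b * M₂ i j) ∧ (∀ i j, i - j ≠ c → M₂ i j = 0)) := by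
  rw [Hg_iff hω.pow_eq_one, ← cond_M hω, ← cond_M hω]
  constructor
  · rintro ⟨⟨t1, -, -, -⟩, ⟨-, -, -, p4, p5⟩, ⟨q1, q2, q3, q4, q5⟩, ⟨r1, r2, r3, r4, r5⟩⟩
    have n1 : ω ≠ W3 ω 0 := by
      have h10 := W3_ne hω (show (1 : Fin 3) ≠ 0 by decide)
      rwa [W3_one] at h10
    have n2 : ω ^ 2 ≠ W3 ω 0 := by rw [← W3_two ω]; exact W3_ne hω (by decide)
    exact ⟨smul_inj n1 p4, smul_inj n2 p5, t1, ⟨q1, r1⟩, ⟨q2, r2⟩⟩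
  · rintro ⟨rfl, rfl, rfl, ⟨q1, r1⟩, ⟨q2, r2⟩⟩
    have z1 : swT (0 : T3 F) = 0 := rfl
    have z2 : shT (0 : T3 F) = 0 := rfl
    have z3 : dgT ω (0 : T3 F) = 0 := by refine T3_ext fun i j k => ?_; simp [dgT]
    have z4 : dgN ω (0 : T3 F) = 0 := by refine T3_ext fun i j k => ?_; simp [dgN]
    simp only [z1, z2, z3, z4, smul_zero, W3_zero, one_smul, q1, q2, r1, r2, and_self]

/-- Homogeneous elements of degree `(1,b,c)`. -/
lemma Hg_one {ω : F} (hω : IsPrimitiveRoot ω 3) (b c : Fin 3) (M₁ M₂ M₃ : gl3 F) (x y : T3 F) :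
    Hg ω 1 b c ((M₁, M₂, M₃), (x, y)) ↔
    M₁ = 0 ∧ M₂ = 0 ∧ M₃ = 0 ∧ y = 0 ∧
    (∀ i j k, x (i - 1) (j - 1) (k - 1) = W3 ω b * x i j k) ∧
    (∀ i j k, i + j + k ≠ c → x i j k = 0) ∧ (∀ i j k, x i k j = x i j k) := by
  rw [Hg_iff hω.pow_eq_one, ← cond_T hω, ← cond_sh]
  have n0 : (1 : F) ≠ W3 ω 1 := by rw [← W3_zero ω]; exact W3_ne hω (by decide)
  have n2 : ω ^ 2 ≠ W3 ω 1 := by rw [← W3_two ω]; exact W3_ne hω (by decide)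
  constructor
  · rintro ⟨⟨-, -, t3, -⟩, ⟨p1, p2, p3, p4, p5⟩, ⟨q1, q2, q3, q4, q5⟩, ⟨r1, r2, r3, r4, r5⟩⟩
    exact ⟨smul_inj n0 (by rw [one_smul]; exact p1), smul_inj n0 (by rw [one_smul]; exact p2),
      smul_inj n0 (by rw [one_smul]; exact p3), smul_inj n2 p5, q4, r4,
      fun i j k => congrFun (congrFun (congrFun t3 i) j) k⟩
  · rintro ⟨rfl, rfl, rfl, rfl, q, r, t⟩
    have t' : swT x = x := T3_ext t
    have z1 : swT (0 : T3 F) = 0 := rfl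
    have z2 : shT (0 : T3 F) = 0 := rfl
    have z3 : shM (0 : gl3 F) = 0 := rfl
    have z4 : dgN ω (0 : T3 F) = 0 := by refine T3_ext fun i j k => ?_; simp [dgN]
    have z5 : dgM ω (0 : gl3 F) = 0 := by ext i j; simp [dgM]
    simp only [z1, z2, z3, z4, z5, smul_zero, W3_one, q, r, t', and_self]

/-- Homogeneous elements of degree `(2,b,c)`. -/
lemma Hg_two {ω : F} (hω : IsPrimitiveRoot ω 3) (b c : Fin 3) (M₁ M₂ M₃ : gl3 F) (x y : T3 F) :
    Hg ω 2 b c ((M₁, M₂, M₃), (x, y)) ↔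
    M₁ = 0 ∧ M₂ = 0 ∧ M₃ = 0 ∧ x = 0 ∧
    (∀ i j k, y (i - 1) (j - 1) (k - 1) = W3 ω b * y i j k) ∧
    (∀ i j k, i + j + k ≠ -c → y i j k = 0) ∧ (∀ i j k, y i k j = y i j k) := by
  rw [Hg_iff hω.pow_eq_one, ← cond_N hω, ← cond_sh]
  have n0 : (1 : F) ≠ W3 ω 2 := by rw [← W3_zero ω]; exact W3_ne hω (by decide)
  have n2 : W3 ω 1 ≠ W3 ω 2 := W3_ne hω (by decide)
  rw [W3_one] at n2
  constructor
  · rintro ⟨⟨-, -, -, t3⟩, ⟨p1, p2, p3, p4, p5⟩, ⟨q1, q2, q3, q4, q5⟩, ⟨r1, r2, r3, r4, r5⟩⟩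
    exact ⟨smul_inj n0 (by rw [one_smul]; exact p1), smul_inj n0 (by rw [one_smul]; exact p2),
      smul_inj n0 (by rw [one_smul]; exact p3), smul_inj n2 p4, q5, r5,
      fun i j k => congrFun (congrFun (congrFun t3 i) j) k⟩
  · rintro ⟨rfl, rfl, rfl, rfl, q, r, t⟩
    have t' : swT y = y := T3_ext t
    have z1 : swT (0 : T3 F) = 0 := rfl
    have z2 : shT (0 : T3 F) = 0 := rfl
    have z3 : shM (0 : gl3 F) = 0 := rfl
    have z4 : dgT ω (0 : T3 F) = 0 := by refine T3_ext fun i j k => ?_; simp [dgT]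
    have z5 : dgM ω (0 : gl3 F) = 0 := by ext i j; simp [dgM]
    simp only [z1, z2, z3, z4, z5, smul_zero, W3_two, q, r, t', and_self]

lemma comp_zero {ω : F} (hω : IsPrimitiveRoot ω 3) : Ltau F ⊓ Lcomp F ω (0, 0, 0) = ⊥ := by
  rw [eq_bot_iff]
  rintro ⟨⟨⟨M₁, M₂, M₃⟩, x, y⟩, hu⟩ h
  obtain ⟨t1, t2, -⟩ := (mem_Lsub _).1 hu
  obtain ⟨rfl, rfl, rfl, ⟨q1, r1⟩, ⟨q2, r2⟩⟩ := (Hg_zero hω 0 0 M₁ M₂ M₃ x y).1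
    ((mem_inf ω (0, 0, 0) _).1 h)
  have key : ∀ M : gl3 F, Matrix.trace M = 0 →
      (∀ i j, M (i - 1) (j - 1) = W3 ω 0 * M i j) → (∀ i j, i - j ≠ 0 → M i j = 0) → M = 0 := by
    intro M t q r
    refine M_inj hω.pow_eq_one 0 0 M q r ?_
    have e1 : M 0 0 = M 1 1 := by simpa [W3_zero] using q 1 1
    have e2 : M 1 1 = M 2 2 := by simpa [W3_zero] using q 2 2
    rw [Matrix.trace_fin_three, ← e2, ← e1] at t
    have t3 : (3 : F) * M 0 0 = 0 := by linear_combination t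
    rw [neg_zero]
    exact (mul_eq_zero.1 t3).resolve_left three_ne_zero
  have k1 := key M₁ t1 q1 r1
  have k2 := key M₃ t2 q2 r2
  subst k1 k2
  exact Subtype.ext rfl

lemma comp_two {ω : F} (hω : IsPrimitiveRoot ω 3) (g : ZMod 3 × ZMod 3 × ZMod 3)
    (hg : g ≠ (0, 0, 0)) : Module.finrank F ↥(Ltau F ⊓ Lcomp F ω g) = 2 := by
  have h3 := hω.pow_eq_one
  obtain ⟨a, b, c⟩ := g
  have ha : a = 0 ∨ a = 1 ∨ a = 2 := by clear hg; revert a; decide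
  have tz : Matrix.trace (0 : gl3 F) = 0 := Matrix.trace_zero _ _
  let b' : Fin 3 := b
  let c' : Fin 3 := c
  rcases ha with rfl | rfl | rfl
  · have hbc : ¬ (b' = 0 ∧ c' = 0) := by
      rintro ⟨h1, h2⟩
      exact hg (Prod.ext rfl (Prod.ext h1 h2))
    let e : ↥(Lsub F) →ₗ[F] F × F :=
      { toFun := fun u => (u.1.1.1 0 (-c'), u.1.1.2.1 0 (-c'))
        map_add' := fun _ _ => rfl
        map_smul' := fun _ _ => rfl }
    refine finrank_two _ e ?_ ?_
    · rintro ⟨⟨⟨M₁, M₂, M₃⟩, x, y⟩, hu⟩ h he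
      obtain ⟨rfl, rfl, rfl, ⟨q1, r1⟩, ⟨q2, r2⟩⟩ := (Hg_zero hω b' c' M₁ M₂ M₃ x y).1
        ((mem_inf ω (0, b, c) _).1 h)
      have he' := Prod.ext_iff.1 he
      have k1 := M_inj h3 b' c' M₁ q1 r1 he'.1
      have k2 := M_inj h3 b' c' M₃ q2 r2 he'.2
      subst k1 k2
      exact Subtype.ext rfl
    · intro s t
      obtain ⟨M, q1, r1, t1, v1⟩ := M_surj hω b' c' hbc s
      obtain ⟨N, q2, r2, t2, v2⟩ := M_surj hω b' c' hbc t
      refine ⟨⟨((M, N, N), (0, 0)), (mem_Lsub _).2 ⟨t1, t2, t2⟩⟩, ?_, Prod.ext v1 v2⟩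
      exact (mem_inf ω (0, b, c) _).2 ((Hg_zero hω b' c' _ _ _ _ _).2
        ⟨rfl, rfl, rfl, ⟨q1, r1⟩, ⟨q2, r2⟩⟩)
  · let e : ↥(Lsub F) →ₗ[F] F × F :=
      { toFun := fun u => (u.1.2.1 0 (-c') (-c'), u.1.2.1 0 (-c' + 1) (-c' - 1))
        map_add' := fun _ _ => rfl
        map_smul' := fun _ _ => rfl }
    refine finrank_two _ e ?_ ?_
    · rintro ⟨⟨⟨M₁, M₂, M₃⟩, x, y⟩, hu⟩ h he
      obtain ⟨rfl, rfl, rfl, rfl, q, r, t⟩ := (Hg_one hω b' c' M₁ M₂ M₃ x y).1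
        ((mem_inf ω (1, b, c) _).1 h)
      have he' := Prod.ext_iff.1 he
      have k1 := T_inj h3 b' c' x q r t he'.1 he'.2
      subst k1
      exact Subtype.ext rfl
    · intro s t
      obtain ⟨x, q, r, w, v1, v2⟩ := T_surj h3 b' c' s t
      refine ⟨⟨((0, 0, 0), (x, 0)), (mem_Lsub _).2 ⟨tz, tz, tz⟩⟩, ?_, Prod.ext v1 v2⟩
      exact (mem_inf ω (1, b, c) _).2 ((Hg_one hω b' c' _ _ _ _ _).2
        ⟨rfl, rfl, rfl, rfl, q, r, w⟩)
  · let e : ↥(Lsub F) →ₗ[F] F × F :=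
      { toFun := fun u => (u.1.2.2 0 (-(-c')) (-(-c')), u.1.2.2 0 (-(-c') + 1) (-(-c') - 1))
        map_add' := fun _ _ => rfl
        map_smul' := fun _ _ => rfl }
    refine finrank_two _ e ?_ ?_
    · rintro ⟨⟨⟨M₁, M₂, M₃⟩, x, y⟩, hu⟩ h he
      obtain ⟨rfl, rfl, rfl, rfl, q, r, t⟩ := (Hg_two hω b' c' M₁ M₂ M₃ x y).1
        ((mem_inf ω (2, b, c) _).1 h)
      have he' := Prod.ext_iff.1 he
      have k1 := T_inj h3 b' (-c') y q r t he'.1 he'.2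
      subst k1
      exact Subtype.ext rfl
    · intro s t
      obtain ⟨x, q, r, w, v1, v2⟩ := T_surj h3 b' (-c') s t
      refine ⟨⟨((0, 0, 0), (0, x)), (mem_Lsub _).2 ⟨tz, tz, tz⟩⟩, ?_, Prod.ext v1 v2⟩
      exact (mem_inf ω (2, b, c) _).2 ((Hg_two hω b' c' _ _ _ _ _).2
        ⟨rfl, rfl, rfl, rfl, q, r, w⟩)

end aux

/-- with `X₂ = X₃` and the same fixed basis, the automorphisms `φ₁, φ₂, φ₃`
commute with `τ`, hence restrict to the 52-dimensional fixed subalgebra `L^τ`; the induced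
decomposition `L^τ = ⊕_{g ∈ ℤ₃³} (L^τ ∩ L_g)` is a `ℤ₃³`-grading of `L^τ` whose zero
component is `0` and whose 26 nonzero components all have dimension 2. -/
theorem f4_Z3_cubed_grading (ω : F) (hω : IsPrimitiveRoot ω 3) :
    -- the φᵢ commute with τ (on L)
    ((∀ u : ↥(Lsub F), phi1 F ω (tau F ↑u) = tau F (phi1 F ω ↑u)) ∧
      (∀ u : ↥(Lsub F), phi2 F (tau F ↑u) = tau F (phi2 F ↑u)) ∧
      (∀ u : ↥(Lsub F), phi3 F ω (tau F ↑u) = tau F (phi3 F ω ↑u))) ∧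
    -- hence map the fixed subalgebra L^τ into itself
    ((∀ u : ↥(Lsub F), u ∈ Ltau F → ∀ h : phi1 F ω ↑u ∈ Lsub F,
        (⟨phi1 F ω ↑u, h⟩ : ↥(Lsub F)) ∈ Ltau F) ∧
      (∀ u : ↥(Lsub F), u ∈ Ltau F → ∀ h : phi2 F ↑u ∈ Lsub F,
        (⟨phi2 F ↑u, h⟩ : ↥(Lsub F)) ∈ Ltau F) ∧
      (∀ u : ↥(Lsub F), u ∈ Ltau F → ∀ h : phi3 F ω ↑u ∈ Lsub F,
        (⟨phi3 F ω ↑u, h⟩ : ↥(Lsub F)) ∈ Ltau F)) ∧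
    -- the induced decomposition of L^τ is a direct sum decomposition ...
    DirectSum.IsInternal
      (fun g : ZMod 3 × ZMod 3 × ZMod 3 => Submodule.comap (Ltau F).subtype (Lcomp F ω g)) ∧
    -- ... compatible with the bracket,
    (∀ g h : ZMod 3 × ZMod 3 × ZMod 3,
      ∀ u ∈ Ltau F ⊓ Lcomp F ω g, ∀ v ∈ Ltau F ⊓ Lcomp F ω h,
        Bsub F u v ∈ Ltau F ⊓ Lcomp F ω (g + h)) ∧
    -- with zero component 0 and all 26 nonzero components of dimension 2
    (Ltau F ⊓ Lcomp F ω (0, 0, 0) = ⊥ ∧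
      ∀ g : ZMod 3 × ZMod 3 × ZMod 3, g ≠ (0, 0, 0) →
        Module.finrank F ↥(Ltau F ⊓ Lcomp F ω g) = 2) := by
  have h3 := hω.pow_eq_one
  refine ⟨⟨fun u => phi1_tau ω u.1, fun u => phi2_tau u.1, fun u => phi3_tau h3 u.1⟩,
    ⟨?_, ?_, ?_⟩, Ltau_isInternal hω, ?_, comp_zero hω, comp_two hω⟩
  · intro u hu h
    rw [mem_Ltau] at hu ⊢
    show tau F (phi1 F ω u.1) = phi1 F ω u.1
    rw [← phi1_tau, hu]
  · intro u hu h
    rw [mem_Ltau] at hu ⊢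
    show tau F (phi2 F u.1) = phi2 F u.1
    rw [← phi2_tau, hu]
  · intro u hu h
    rw [mem_Ltau] at hu ⊢
    show tau F (phi3 F ω u.1) = phi3 F ω u.1
    rw [← phi3_tau h3, hu]
  · intro g h u hu v hv
    rw [mem_inf] at hu hv ⊢
    exact Hg_B h3 hu hv

end
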